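/- Let n ≥ 1, let X be an n×n real Gaussian matrix, let ε ∈ (0,1), let f(X) = perm(X)² and g(X) = E[perm(Y)² | X], where Y is an ε-noise of X. Then the correlation between f(X) and g(X) equals (Σ_{m=1}^{n} (m+1)·(1−ε)^m) / ( √(Σ_{m=1}^{n} (m+1)) · √(Σ_{m=1}^{n} (m+1)·(1−ε)^{2m}) ). -/

import Mathlib

open MeasureTheory ProbabilityTheory Filter

/-- The distribution of an n×n real Gaussian matrix: i.i.d. standard real Gaussian
entries (mean 0, variance 1). -/
noncomputable def gMatR (n : ℕ) : Measure (Fin n → Fin n → ℝ) :=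
  Measure.pi fun _ => Measure.pi fun _ => gaussianReal 0 1

/-- The permanent of an n×n real matrix. -/
noncomputable def rperm {n : ℕ} (A : Fin n → Fin n → ℝ) : ℝ :=
  ∑ σ : Equiv.Perm (Fin n), ∏ i, A i (σ i)

/-- The ε-noise of a matrix X with noise matrix U: √(1-ε)·X + √ε·U. -/
noncomputable def noisyR {n : ℕ} (ε : ℝ) (X U : Fin n → Fin n → ℝ) : Fin n → Fin n → ℝ :=
  fun i j => Real.sqrt (1 - ε) * X i j + Real.sqrt ε * U i j

/-- g(X) = E[perm(Y)² | X], where Y is an ε-noise of X: since the noise matrix U is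
independent of X, this conditional expectation is the integral over U. -/
noncomputable def gFunR (n : ℕ) (ε : ℝ) (X : Fin n → Fin n → ℝ) : ℝ :=
  ∫ U, (rperm (noisyR ε X U)) ^ 2 ∂(gMatR n)

/-- Covariance of two real random variables: Cov(f,g) = E[(f - E f)(g - E g)]. -/
noncomputable def cov {α : Type*} [MeasurableSpace α] (μ : Measure α) (f g : α → ℝ) : ℝ :=
  ∫ x, (f x - ∫ y, f y ∂μ) * (g x - ∫ y, g y ∂μ) ∂μ

/-- Correlation: corr(f,g) = Cov(f,g)/(√Var(f)·√Var(g)). -/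
noncomputable def corr {α : Type*} [MeasurableSpace α] (μ : Measure α) (f g : α → ℝ) : ℝ :=
  cov μ f g / (Real.sqrt (cov μ f f) * Real.sqrt (cov μ g g))

section Moments
open scoped Nat

lemma integrable_pow_gaussianReal (k : ℕ) : Integrable (fun x : ℝ => x ^ k) (gaussianReal 0 1) := by
  have h := (memLp_id_gaussianReal (μ := 0) (v := 1) k).integrable_norm_pow'
  have h2 : Integrable (fun x : ℝ => ‖x ^ k‖) (gaussianReal 0 1) := by simpa using h
  exact (integrable_norm_iff (by fun_prop)).1 h2

lemma integral_pow_gaussianReal_le_four :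
    (∫ x : ℝ, x ^ 1 ∂gaussianReal 0 1) = 0 ∧ (∫ x : ℝ, x ^ 2 ∂gaussianReal 0 1) = 1 ∧
    (∫ x : ℝ, x ^ 3 ∂gaussianReal 0 1) = 0 ∧ (∫ x : ℝ, x ^ 4 ∂gaussianReal 0 1) = 3 := by
  have key : ∀ k : ℕ, (∫ x : ℝ, x ^ k ∂gaussianReal 0 1)
      = iteratedDeriv k (fun t : ℝ => Real.exp (t ^ 2 / 2)) 0 := by
    intro k
    have h := iteratedDeriv_mgf_zero (X := id) (μ := gaussianReal 0 1)
      (by simp [integrableExpSet_id_gaussianReal]) k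
    rw [mgf_id_gaussianReal] at h
    simpa using h.symm
  have d (p p' : ℝ → ℝ) (hp : ∀ t, HasDerivAt p (p' t) t) :
      deriv (fun t : ℝ => p t * Real.exp (t ^ 2 / 2))
        = fun t => (p' t + p t * t) * Real.exp (t ^ 2 / 2) := by
    ext t
    have h1 : HasDerivAt (fun t : ℝ => t ^ 2 / 2) t t := by
      simpa using (hasDerivAt_pow 2 t).div_const 2
    have h2 := (hp t).fun_mul h1.exp
    rw [h2.deriv]
    ring
  have h1 : iteratedDeriv 1 (fun t : ℝ => Real.exp (t ^ 2 / 2))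
      = fun t => t * Real.exp (t ^ 2 / 2) := by
    rw [iteratedDeriv_one]
    simpa using d (fun _ => 1) (fun _ => 0) (fun t => hasDerivAt_const t 1)
  have h2 : iteratedDeriv 2 (fun t : ℝ => Real.exp (t ^ 2 / 2))
      = fun t => (1 + t * t) * Real.exp (t ^ 2 / 2) := by
    rw [iteratedDeriv_succ, h1]
    exact d (fun t => t) (fun _ => 1) hasDerivAt_id'
  have h3 : iteratedDeriv 3 (fun t : ℝ => Real.exp (t ^ 2 / 2))
      = fun t => (2 * t + (1 + t * t) * t) * Real.exp (t ^ 2 / 2) := by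
    rw [iteratedDeriv_succ, h2]
    refine d (fun t => 1 + t * t) (fun t => 2 * t) fun t => ?_
    convert! ((hasDerivAt_id' t).mul (hasDerivAt_id' t)).const_add 1 using 1
    ring
  have h4 : iteratedDeriv 4 (fun t : ℝ => Real.exp (t ^ 2 / 2))
      = fun t => (3 + 3 * t ^ 2 + (2 * t + (1 + t * t) * t) * t) * Real.exp (t ^ 2 / 2) := by
    rw [iteratedDeriv_succ, h3]
    refine d (fun t => 2 * t + (1 + t * t) * t) (fun t => 3 + 3 * t ^ 2) fun t => ?_
    convert! ((hasDerivAt_id' t).const_mul 2).add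
      ((((hasDerivAt_id' t).mul (hasDerivAt_id' t)).const_add 1).mul (hasDerivAt_id' t)) using 1
    simp; ring
  refine ⟨?_, ?_, ?_, ?_⟩ <;> rw [key]
  · simp [h1]
  · simp [h2]
  · simp [h3]
  · simp [h4]

section Row
variable {ι : Type*} [Fintype ι]

lemma integrable_prod_pow_gaussian (m : ι → ℕ) :
    Integrable (fun x : ι → ℝ => ∏ j, x j ^ m j) (Measure.pi fun _ => gaussianReal 0 1) :=
  Integrable.fintype_prod (f := fun j (y : ℝ) => y ^ m j) fun j => integrable_pow_gaussianReal (m j)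

lemma integral_prod_pow_gaussian (m : ι → ℕ) :
    ∫ x : ι → ℝ, ∏ j, x j ^ m j ∂(Measure.pi fun _ => gaussianReal 0 1)
      = ∏ j, ∫ y : ℝ, y ^ m j ∂gaussianReal 0 1 :=
  integral_fintype_prod_eq_prod (f := fun j (y : ℝ) => y ^ m j)

variable [DecidableEq ι]

lemma prod_pow_ite_eq (x : ι → ℝ) (a : ι) : ∏ j, x j ^ (if j = a then 1 else 0) = x a := by
  simp

lemma mul_eq_prod_pow (x : ι → ℝ) (a b : ι) :
    x a * x b = ∏ j, x j ^ ((if j = a then 1 else 0) + (if j = b then 1 else 0)) := by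
  simp only [pow_add, Finset.prod_mul_distrib, prod_pow_ite_eq]

lemma mul_mul_mul_eq_prod_pow (x : ι → ℝ) (a b c d : ι) :
    x a * x b * (x c * x d) = ∏ j, x j ^ ((if j = a then 1 else 0) + (if j = b then 1 else 0)
      + ((if j = c then 1 else 0) + (if j = d then 1 else 0))) := by
  simp only [pow_add, Finset.prod_mul_distrib, prod_pow_ite_eq]

lemma integrable_mul_gaussian (a b : ι) :
    Integrable (fun x : ι → ℝ => x a * x b) (Measure.pi fun _ => gaussianReal 0 1) := by
  simp only [mul_eq_prod_pow]
  exact integrable_prod_pow_gaussian _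

lemma integrable_mul_mul_mul_gaussian (a b c d : ι) :
    Integrable (fun x : ι → ℝ => x a * x b * (x c * x d))
      (Measure.pi fun _ => gaussianReal 0 1) := by
  simp only [mul_mul_mul_eq_prod_pow]
  exact integrable_prod_pow_gaussian _

lemma integrable_eval_gaussian (a : ι) :
    Integrable (fun x : ι → ℝ => x a) (Measure.pi fun _ => gaussianReal 0 1) := by
  simp only [← prod_pow_ite_eq _ a]
  exact integrable_prod_pow_gaussian _

lemma integral_eval_gaussian (a : ι) :
    ∫ x : ι → ℝ, x a ∂(Measure.pi fun _ => gaussianReal 0 1) = 0 := by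
  simp only [← prod_pow_ite_eq _ a]
  rw [integral_prod_pow_gaussian]
  exact Finset.prod_eq_zero (Finset.mem_univ a)
    (by simp)

lemma integral_mul_gaussian (a b : ι) :
    ∫ x : ι → ℝ, x a * x b ∂(Measure.pi fun _ => gaussianReal 0 1) = if a = b then 1 else 0 := by
  simp only [mul_eq_prod_pow]
  rw [integral_prod_pow_gaussian]
  obtain ⟨-, m2, -, -⟩ := integral_pow_gaussianReal_le_four
  by_cases h : a = b
  · subst h
    rw [if_pos rfl]
    refine Finset.prod_eq_one fun j _ => ?_
    by_cases hj : j = a <;> simp [hj, m2]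
  · rw [if_neg h]
    exact Finset.prod_eq_zero (Finset.mem_univ a) (by simp [h])

/-- Isserlis' formula for four coordinates of a standard Gaussian vector. -/
lemma integral_mul_mul_mul_gaussian (a b c d : ι) :
    ∫ x : ι → ℝ, x a * x b * (x c * x d) ∂(Measure.pi fun _ => gaussianReal 0 1)
      = (if a = b ∧ c = d then 1 else 0) + (if a = c ∧ b = d then 1 else 0)
        + (if a = d ∧ b = c then 1 else 0) := by
  simp only [mul_mul_mul_eq_prod_pow]
  rw [integral_prod_pow_gaussian]
  obtain ⟨-, m2, m3, m4⟩ := integral_pow_gaussianReal_le_four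
  have val (j : ι) : ∫ y : ℝ, y ^ ((if j = a then 1 else 0) + (if j = b then 1 else 0)
      + ((if j = c then 1 else 0) + (if j = d then 1 else 0))) ∂gaussianReal 0 1
      = if j = a then (if j = b then (if j = c then if j = d then 3 else 0
            else if j = d then 0 else 1)
          else if j = c then (if j = d then 0 else 1) else if j = d then 1 else 0)
        else (if j = b then (if j = c then if j = d then 0 else 1
            else if j = d then 1 else 0)
          else if j = c then (if j = d then 1 else 0) else if j = d then 0 else 1) := by
    split_ifs <;> simp [m2, m3, m4]
  simp only [val]
  by_cases hall : a = b ∧ a = c ∧ a = d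
  · obtain ⟨rfl, rfl, rfl⟩ := hall
    rw [Finset.prod_eq_single a (fun j _ hj => by simp [hj]) (by simp)]
    norm_num
  by_cases h : (a = b ∧ c = d) ∨ (a = c ∧ b = d) ∨ (a = d ∧ b = c)
  · rw [Finset.prod_eq_one fun j _ => by grind]
    grind
  · push Not at h
    have hR : ((if a = b ∧ c = d then 1 else 0) + (if a = c ∧ b = d then 1 else 0)
        + (if a = d ∧ b = c then 1 else 0) : ℝ) = 0 := by grind
    rw [hR]
    by_cases hab : a = b
    · exact Finset.prod_eq_zero (Finset.mem_univ c) (by grind)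
    · by_cases hacd : a = c ∨ a = d
      · exact Finset.prod_eq_zero (Finset.mem_univ b) (by grind)
      · exact Finset.prod_eq_zero (Finset.mem_univ a) (by grind)
end Row

section Count
variable {α : Type*} [Fintype α] [DecidableEq α]

/-- The compatibility of the values `j k l` with the pairing `p` of the four points `i j k l`. -/
def PairedBy {β : Type*} (p : Fin 3) (i j k l : β) : Prop :=
  (p = 0 → i = j ∧ k = l) ∧ (p = 1 → i = k ∧ j = l) ∧ (p = 2 → i = l ∧ j = k)

instance {β : Type*} [DecidableEq β] (p : Fin 3) (i j k l : β) :
    Decidable (PairedBy p i j k l) := by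
  unfold PairedBy
  infer_instance

lemma card_paired_perms (c : α → Fin 3) :
    Nat.card {q : Equiv.Perm α × Equiv.Perm α × Equiv.Perm α //
      ∀ i, PairedBy (c i) i (q.1 i) (q.2.1 i) (q.2.2 i)} =
      ∏ p, (Fintype.card {i // c i = p})! := by
  rw [← DomMulAct.stabilizer_card c, ← Nat.card_eq_fintype_card]
  have inj (g : {g : Equiv.Perm α // c ∘ g = c}) (p : Fin 3) :
      Function.Bijective fun i => if c i = p then i else g.1 i := by
    rw [Fintype.bijective_iff_injective_and_card]
    refine ⟨fun i j h => ?_, rfl⟩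
    have hg : ∀ i, c (g.1 i) = c i := fun i => congrFun g.2 i
    have := hg i
    have := hg j
    have := g.1.injective (a₁ := i) (a₂ := j)
    grind
  let R (g : {g : Equiv.Perm α // c ∘ g = c}) (p : Fin 3) : Equiv.Perm α :=
    Equiv.ofBijective _ (inj g p)
  have hR g p i : R g p i = if c i = p then i else g.1 i := rfl
  symm
  refine Nat.card_eq_of_bijective
    (fun g => ⟨(R g 0, R g 1, R g 2), fun i => ?_⟩) ⟨fun g g' h => ?_, ?_⟩
  · simp only [hR, PairedBy]
    grind
  · simp only [Subtype.mk.injEq, Prod.mk.injEq, Equiv.ext_iff, hR] at h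
    ext i
    have := h.1 i
    have := h.2.1 i
    grind
  · rintro ⟨⟨τ, π, ρ⟩, h⟩
    simp only [PairedBy] at h
    have inv : ∀ i, c (if c i = 0 then π i else τ i) = c i := by
      intro i
      have h1 := h i
      have h2 := h (π i)
      have h3 := h (τ i)
      have := π.injective (a₁ := π i) (a₂ := i)
      have := τ.injective (a₁ := τ i) (a₂ := i)
      have := ρ.injective (a₁ := ρ i) (a₂ := i)
      generalize hci : c i = p at *
      generalize hcp : c (π i) = p' at *
      generalize hct : c (τ i) = p'' at *
      fin_cases p <;> fin_cases p' <;> fin_cases p'' <;> grind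
    have bij : Function.Bijective fun i => if c i = 0 then π i else τ i := by
      rw [Fintype.bijective_iff_injective_and_card]
      refine ⟨fun i j hij => ?_, rfl⟩
      have := inv i
      have := inv j
      have := π.injective (a₁ := i) (a₂ := j)
      have := τ.injective (a₁ := i) (a₂ := j)
      grind
    refine ⟨⟨Equiv.ofBijective _ bij, funext inv⟩, Subtype.ext ?_⟩
    simp only [Prod.mk.injEq, Equiv.ext_iff, hR, Equiv.ofBijective_apply]
    refine ⟨fun i => ?_, fun i => ?_, fun i => ?_⟩ <;> have h1 := h i <;>
      generalize c i = p at * <;> fin_cases p <;> grind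

open Finset in
lemma sum_factorial_mul_pow (t : ℝ) :
    ∑ S : Finset α, ∑ T ∈ Sᶜ.powerset, t ^ #Sᶜ * ((#S)! * ((#T)! * (#(Sᶜ \ T))!) : ℕ)
      = (Fintype.card α)! * ∑ m ∈ range (Fintype.card α + 1), ((m : ℝ) + 1) * t ^ m := by
  have inner (U : Finset α) : ∑ T ∈ U.powerset, (((#T)! * (#(U \ T))! : ℕ) : ℝ)
      = (#U + 1) * (#U)! := by
    rw [sum_congr rfl (g := fun T => (((#T)! * (#U - #T)! : ℕ) : ℝ))
      fun T hT => by rw [card_sdiff_of_subset (mem_powerset.1 hT)],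
      sum_powerset_apply_card (fun k => ((k ! * (#U - k)! : ℕ) : ℝ))]
    rw [sum_congr rfl (g := fun _ => ((#U)! : ℝ))]
    · simp
    · intro k hk
      rw [nsmul_eq_mul, ← Nat.cast_mul, ← mul_assoc,
        Nat.choose_mul_factorial_mul_factorial (by simpa [Nat.lt_succ_iff] using hk)]
  calc _ = ∑ S : Finset α, t ^ #S * ((Fintype.card α - #S)! * ((#S + 1) * (#S)!) : ℝ) := by
        rw [← Equiv.sum_comp (compl_involutive (α := Finset α)).toPerm]
        refine sum_congr rfl fun S _ => ?_
        simp only [Function.Involutive.coe_toPerm, compl_compl, ← mul_sum, Nat.cast_mul, card_compl]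
        rw [← inner]
        push_cast
        rfl
    _ = _ := by
        rw [← powerset_univ, sum_powerset_apply_card (fun k =>
          t ^ k * ((Fintype.card α - k)! * ((k + 1) * k !) : ℝ)), mul_sum, card_univ]
        refine sum_congr rfl fun m hm => ?_
        rw [nsmul_eq_mul, ← Nat.choose_mul_factorial_mul_factorial
          (show m ≤ Fintype.card α by simpa [Nat.lt_succ_iff] using hm)]
        push_cast
        ring

/-- The fourth-moment weight of a row. -/
noncomputable def pairingWeight {β : Type*} [DecidableEq β] (t : ℝ) (a b c d : β) : ℝ :=
  (if a = b ∧ c = d then 1 else 0) +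
    (t * (if a = c ∧ b = d then 1 else 0) + t * (if a = d ∧ b = c then 1 else 0))

open Finset in
lemma sum_prod_pairingWeight_id (t : ℝ) :
    ∑ τ : Equiv.Perm α, ∑ π : Equiv.Perm α, ∑ ρ : Equiv.Perm α,
      ∏ i, pairingWeight t i (τ i) (π i) (ρ i)
      = (Fintype.card α)! * ∑ m ∈ range (Fintype.card α + 1), ((m : ℝ) + 1) * t ^ m := by
  let c (S T : Finset α) (i : α) : Fin 3 := if i ∈ S then 0 else if i ∈ T then 1 else 2
  have expand (q : Equiv.Perm α × Equiv.Perm α × Equiv.Perm α) :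
      ∏ i, pairingWeight t i (q.1 i) (q.2.1 i) (q.2.2 i)
        = ∑ S : Finset α, ∑ T ∈ Sᶜ.powerset, t ^ #Sᶜ *
          if ∀ i, PairedBy (c S T i) i (q.1 i) (q.2.1 i) (q.2.2 i) then 1 else 0 := by
    simp only [pairingWeight]
    rw [Fintype.prod_add]
    refine sum_congr rfl fun S _ => ?_
    rw [prod_add, mul_sum]
    refine sum_congr rfl fun T hT => ?_
    have hT := mem_powerset.1 hT
    rw [prod_mul_distrib, prod_mul_distrib, prod_const, prod_const,
      ← card_sdiff_add_card_eq_card hT, pow_add, prod_boole, prod_boole, prod_boole]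
    have : (∀ i, PairedBy (c S T i) i (q.1 i) (q.2.1 i) (q.2.2 i)) ↔
        (∀ i ∈ S, i = q.1 i ∧ q.2.1 i = q.2.2 i) ∧ (∀ i ∈ T, i = q.2.1 i ∧ q.1 i = q.2.2 i) ∧
        (∀ i ∈ Sᶜ \ T, i = q.2.2 i ∧ q.1 i = q.2.1 i) := by
      rw [← forall_and, ← forall_and]
      refine forall_congr' fun i => ?_
      have : i ∈ T → i ∉ S := fun h => by simpa using hT h
      simp only [PairedBy, c]
      by_cases hS : i ∈ S <;> by_cases hT : i ∈ T <;> simp_all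
    rw [if_congr this rfl rfl, ite_and, ite_and]
    split_ifs <;> ring
  have hc (S T : Finset α) (hT : T ⊆ Sᶜ) :
      ∏ p, (Fintype.card {i // c S T i = p})! = (#S)! * ((#T)! * (#(Sᶜ \ T))!) := by
    have h (i) : i ∈ T → i ∉ S := fun h => by simpa using hT h
    simp only [Fintype.card_subtype, Fin.prod_univ_three, mul_assoc]
    congr 4 <;> ext i <;> have := h i <;>
      by_cases hS : i ∈ S <;> by_cases hT : i ∈ T <;> simp_all [c]
  rw [← sum_factorial_mul_pow]
  simp only [← Fintype.sum_prod_type']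
  rw [Fintype.sum_congr _ _ expand, sum_comm]
  refine sum_congr rfl fun S _ => ?_
  rw [sum_comm]
  refine sum_congr rfl fun T hT => ?_
  rw [← hc S T (mem_powerset.1 hT), ← card_paired_perms, ← mul_sum, sum_boole,
    Nat.card_eq_fintype_card, Fintype.card_subtype]

open Finset in
lemma sum_prod_pairingWeight (t : ℝ) :
    ∑ σ : Equiv.Perm α, ∑ τ : Equiv.Perm α, ∑ π : Equiv.Perm α, ∑ ρ : Equiv.Perm α,
      ∏ i, pairingWeight t (σ i) (τ i) (π i) (ρ i)
      = ((Fintype.card α)! : ℝ) ^ 2 *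
        ∑ m ∈ range (Fintype.card α + 1), ((m : ℝ) + 1) * t ^ m := by
  rw [sum_congr rfl (g := fun _ => ((Fintype.card α)! : ℝ) *
        ∑ m ∈ range (Fintype.card α + 1), ((m : ℝ) + 1) * t ^ m)]
  · simp [Fintype.card_perm, sq, mul_assoc]
  · intro σ _
    rw [← sum_prod_pairingWeight_id, ← Equiv.sum_comp (Equiv.mulLeft σ)]
    refine sum_congr rfl fun τ _ => ?_
    rw [← Equiv.sum_comp (Equiv.mulLeft σ)]
    refine sum_congr rfl fun π _ => ?_
    rw [← Equiv.sum_comp (Equiv.mulLeft σ)]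
    refine sum_congr rfl fun ρ _ => prod_congr rfl fun i _ => ?_
    simp [pairingWeight]
end Count

section Correlation
variable {n : ℕ}

/-- The row factor of the conditional second moment of a permanent: the expectation of `y a * y b`
for a standard Gaussian row `y` of correlation `√s` with `x`. -/
noncomputable def rowFactor (s : ℝ) (a b : Fin n) (x : Fin n → ℝ) : ℝ :=
  s * (x a * x b) + (1 - s) * if a = b then 1 else 0

/-- The conditional second moment of a permanent, as an explicit polynomial. -/
noncomputable def permSqNoise (n : ℕ) (s : ℝ) (X : Fin n → Fin n → ℝ) : ℝ :=
  ∑ σ : Equiv.Perm (Fin n), ∑ τ : Equiv.Perm (Fin n), ∏ i, rowFactor s (σ i) (τ i) (X i)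

lemma rperm_sq (A : Fin n → Fin n → ℝ) :
    rperm A ^ 2 = ∑ σ : Equiv.Perm (Fin n), ∑ τ : Equiv.Perm (Fin n),
      ∏ i, (A i (σ i) * A i (τ i)) := by
  simp only [rperm, sq, Finset.sum_mul_sum, Finset.prod_mul_distrib]

lemma rperm_sq_eq_permSqNoise : (fun X => rperm X ^ 2) = permSqNoise n 1 := by
  ext X
  simp [rperm_sq, permSqNoise, rowFactor]

lemma noisy_row_mul (p q : ℝ) (x u : Fin n → ℝ) (a b : Fin n) :
    (p * x a + q * u a) * (p * x b + q * u b)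
      = p ^ 2 * (x a * x b) + (p * q * x a) * u b + (p * q * x b) * u a
        + q ^ 2 * (u a * u b) := by
  ring

lemma integrable_noisy_row_mul (p q : ℝ) (x : Fin n → ℝ) (a b : Fin n) :
    Integrable (fun u : Fin n → ℝ => (p * x a + q * u a) * (p * x b + q * u b))
      (Measure.pi fun _ => gaussianReal 0 1) := by
  simp only [noisy_row_mul]
  exact (((integrable_const _).add ((integrable_eval_gaussian b).const_mul _)).add
    ((integrable_eval_gaussian a).const_mul _)).add ((integrable_mul_gaussian a b).const_mul _)

lemma integral_noisy_row_mul (p q : ℝ) (x : Fin n → ℝ) (a b : Fin n) :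
    ∫ u : Fin n → ℝ, (p * x a + q * u a) * (p * x b + q * u b)
      ∂(Measure.pi fun _ => gaussianReal 0 1)
      = p ^ 2 * (x a * x b) + q ^ 2 * if a = b then 1 else 0 := by
  simp only [noisy_row_mul]
  have hb := (integrable_eval_gaussian b).const_mul (p * q * x a)
  have ha := (integrable_eval_gaussian a).const_mul (p * q * x b)
  have hab := (integrable_mul_gaussian a b).const_mul (q ^ 2)
  have hc := integrable_const (μ := Measure.pi fun _ : Fin n => gaussianReal 0 1)
    (p ^ 2 * (x a * x b))
  rw [integral_add ((hc.fun_add hb).fun_add ha) hab, integral_add (hc.fun_add hb) ha,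
    integral_add hc hb]
  simp only [integral_const_mul, integral_eval_gaussian, integral_mul_gaussian]
  simp

lemma gFunR_eq_permSqNoise {ε : ℝ} (h0 : 0 ≤ ε) (h1 : ε ≤ 1) :
    gFunR n ε = permSqNoise n (1 - ε) := by
  ext X
  have hint (σ τ : Equiv.Perm (Fin n)) : Integrable (fun U : Fin n → Fin n → ℝ =>
      ∏ i, (noisyR ε X U i (σ i) * noisyR ε X U i (τ i))) (gMatR n) :=
    Integrable.fintype_prod (f := fun i (u : Fin n → ℝ) =>
      (√(1 - ε) * X i (σ i) + √ε * u (σ i)) * (√(1 - ε) * X i (τ i) + √ε * u (τ i)))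
      fun i => integrable_noisy_row_mul _ _ _ _ _
  simp only [gFunR, rperm_sq, permSqNoise]
  rw [integral_finsetSum _ fun σ _ => integrable_finsetSum _ fun τ _ => hint σ τ]
  refine Finset.sum_congr rfl fun σ _ => ?_
  rw [integral_finsetSum _ fun τ _ => hint σ τ]
  refine Finset.sum_congr rfl fun τ _ => ?_
  refine (integral_fintype_prod_eq_prod (f := fun i (u : Fin n → ℝ) =>
      (√(1 - ε) * X i (σ i) + √ε * u (σ i)) * (√(1 - ε) * X i (τ i) + √ε * u (τ i)))).trans ?_
  refine Finset.prod_congr rfl fun i _ => ?_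
  rw [integral_noisy_row_mul, Real.sq_sqrt h0, Real.sq_sqrt (sub_nonneg.2 h1), rowFactor,
    sub_sub_cancel]

lemma integrable_rowFactor (s : ℝ) (a b : Fin n) :
    Integrable (rowFactor s a b) (Measure.pi fun _ => gaussianReal 0 1) :=
  ((integrable_mul_gaussian a b).const_mul s).add (integrable_const _)

lemma integral_rowFactor (s : ℝ) (a b : Fin n) :
    ∫ x, rowFactor s a b x ∂(Measure.pi fun _ => gaussianReal 0 1) = if a = b then 1 else 0 := by
  simp only [rowFactor]
  rw [integral_add ((integrable_mul_gaussian a b).const_mul s) (integrable_const _),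
    integral_const_mul, integral_mul_gaussian]
  simp
  split_ifs <;> ring

lemma rowFactor_mul (s r : ℝ) (a b c d : Fin n) (x : Fin n → ℝ) :
    rowFactor s a b x * rowFactor r c d x
      = s * r * (x a * x b * (x c * x d))
        + (s * (1 - r) * if c = d then 1 else 0) * (x a * x b)
        + ((1 - s) * r * if a = b then 1 else 0) * (x c * x d)
        + (1 - s) * (1 - r) * ((if a = b then 1 else 0) * if c = d then 1 else 0) := by
  simp only [rowFactor]
  ring

lemma integrable_rowFactor_mul (s r : ℝ) (a b c d : Fin n) :
    Integrable (fun x => rowFactor s a b x * rowFactor r c d x)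
      (Measure.pi fun _ => gaussianReal 0 1) := by
  simp only [rowFactor_mul]
  exact ((((integrable_mul_mul_mul_gaussian a b c d).const_mul _).add
    ((integrable_mul_gaussian a b).const_mul _)).add
    ((integrable_mul_gaussian c d).const_mul _)).add (integrable_const _)

lemma integral_rowFactor_mul (s r : ℝ) (a b c d : Fin n) :
    ∫ x, rowFactor s a b x * rowFactor r c d x ∂(Measure.pi fun _ => gaussianReal 0 1)
      = pairingWeight (s * r) a b c d := by
  simp only [rowFactor_mul]
  have h4 := (integrable_mul_mul_mul_gaussian a b c d).const_mul (s * r)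
  have hab := (integrable_mul_gaussian a b).const_mul (s * (1 - r) * if c = d then 1 else 0)
  have hcd := (integrable_mul_gaussian c d).const_mul ((1 - s) * r * if a = b then 1 else 0)
  rw [integral_add ((h4.fun_add hab).fun_add hcd) (integrable_const _),
    integral_add (h4.fun_add hab) hcd, integral_add h4 hab]
  simp only [integral_const_mul, integral_mul_mul_mul_gaussian, integral_mul_gaussian,
    integral_const, probReal_univ, one_smul, pairingWeight, ite_and]
  split_ifs <;> ring

lemma integrable_permSqNoise (s : ℝ) : Integrable (permSqNoise n s) (gMatR n) :=
  integrable_finsetSum _ fun σ _ => integrable_finsetSum _ fun τ _ =>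
    Integrable.fintype_prod (f := fun i => rowFactor s (σ i) (τ i)) fun _ =>
      integrable_rowFactor _ _ _

lemma integral_permSqNoise (s : ℝ) : ∫ X, permSqNoise n s X ∂(gMatR n) = n ! := by
  have hint (σ τ : Equiv.Perm (Fin n)) : Integrable (fun X : Fin n → Fin n → ℝ =>
      ∏ i, rowFactor s (σ i) (τ i) (X i)) (gMatR n) :=
    Integrable.fintype_prod (f := fun i => rowFactor s (σ i) (τ i)) fun _ =>
      integrable_rowFactor _ _ _
  simp only [permSqNoise]
  rw [integral_finsetSum _ fun σ _ => integrable_finsetSum _ fun τ _ => hint σ τ]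
  have key (σ : Equiv.Perm (Fin n)) : ∫ X : Fin n → Fin n → ℝ, ∑ τ : Equiv.Perm (Fin n),
      ∏ i, rowFactor s (σ i) (τ i) (X i) ∂(gMatR n) = 1 := by
    rw [integral_finsetSum _ fun τ _ => hint σ τ, Finset.sum_eq_single σ]
    · rw [gMatR, integral_fintype_prod_eq_prod (f := fun i => rowFactor s (σ i) (σ i))]
      simp [integral_rowFactor]
    · intro τ _ hτ
      rw [gMatR, integral_fintype_prod_eq_prod (f := fun i => rowFactor s (σ i) (τ i))]
      obtain ⟨i, hi⟩ := not_forall.1 (mt Equiv.ext hτ.symm)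
      exact Finset.prod_eq_zero (Finset.mem_univ i) (by simp [integral_rowFactor, hi])
    · simp
  simp [key, Fintype.card_perm]

lemma permSqNoise_mul (s r : ℝ) (X : Fin n → Fin n → ℝ) :
    permSqNoise n s X * permSqNoise n r X
      = ∑ σ : Equiv.Perm (Fin n), ∑ τ : Equiv.Perm (Fin n), ∑ π : Equiv.Perm (Fin n),
        ∑ ρ : Equiv.Perm (Fin n),
          ∏ i, (rowFactor s (σ i) (τ i) (X i) * rowFactor r (π i) (ρ i) (X i)) := by
  simp only [permSqNoise, Finset.prod_mul_distrib, ← Finset.mul_sum, ← Finset.sum_mul]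

lemma integrable_prod_rowFactor_mul (s r : ℝ) (σ τ π ρ : Equiv.Perm (Fin n)) :
    Integrable (fun X : Fin n → Fin n → ℝ =>
      ∏ i, (rowFactor s (σ i) (τ i) (X i) * rowFactor r (π i) (ρ i) (X i))) (gMatR n) :=
  Integrable.fintype_prod (f := fun i x => rowFactor s (σ i) (τ i) x * rowFactor r (π i) (ρ i) x)
    fun _ => integrable_rowFactor_mul _ _ _ _ _ _

lemma integrable_permSqNoise_mul (s r : ℝ) :
    Integrable (fun X => permSqNoise n s X * permSqNoise n r X) (gMatR n) := by
  simp only [permSqNoise_mul]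
  exact integrable_finsetSum _ fun σ _ => integrable_finsetSum _ fun τ _ =>
    integrable_finsetSum _ fun π _ => integrable_finsetSum _ fun ρ _ =>
      integrable_prod_rowFactor_mul s r σ τ π ρ

lemma integral_permSqNoise_mul (s r : ℝ) :
    ∫ X, permSqNoise n s X * permSqNoise n r X ∂(gMatR n)
      = (n ! : ℝ) ^ 2 * ∑ m ∈ Finset.range (n + 1), ((m : ℝ) + 1) * (s * r) ^ m := by
  have hint := integrable_prod_rowFactor_mul (n := n) s r
  have h := sum_prod_pairingWeight (α := Fin n) (s * r)
  rw [Fintype.card_fin] at h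
  simp only [permSqNoise_mul]
  rw [← h, integral_finsetSum _ fun σ _ => integrable_finsetSum _ fun τ _ =>
    integrable_finsetSum _ fun π _ => integrable_finsetSum _ fun ρ _ => hint σ τ π ρ]
  refine Finset.sum_congr rfl fun σ _ => ?_
  rw [integral_finsetSum _ fun τ _ => integrable_finsetSum _ fun π _ =>
    integrable_finsetSum _ fun ρ _ => hint σ τ π ρ]
  refine Finset.sum_congr rfl fun τ _ => ?_
  rw [integral_finsetSum _ fun π _ => integrable_finsetSum _ fun ρ _ => hint σ τ π ρ]
  refine Finset.sum_congr rfl fun π _ => ?_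
  rw [integral_finsetSum _ fun ρ _ => hint σ τ π ρ]
  refine Finset.sum_congr rfl fun ρ _ => ?_
  rw [gMatR, integral_fintype_prod_eq_prod (f := fun i x =>
    rowFactor s (σ i) (τ i) x * rowFactor r (π i) (ρ i) x)]
  simp only [integral_rowFactor_mul]

lemma cov_permSqNoise (s r : ℝ) :
    cov (gMatR n) (permSqNoise n s) (permSqNoise n r)
      = (n ! : ℝ) ^ 2 * ∑ m ∈ Finset.Icc 1 n, ((m : ℝ) + 1) * (s * r) ^ m := by
  have : IsProbabilityMeasure (gMatR n) := by
    unfold gMatR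
    infer_instance
  have hsum : ∑ m ∈ Finset.range (n + 1), ((m : ℝ) + 1) * (s * r) ^ m
      = 1 + ∑ m ∈ Finset.Icc 1 n, ((m : ℝ) + 1) * (s * r) ^ m := by
    rw [Finset.range_eq_Ico, Finset.sum_eq_sum_Ico_succ_bot (by lia)]
    simp [← Finset.Ico_add_one_right_eq_Icc]
  have hs := integrable_permSqNoise (n := n) s
  have hr := integrable_permSqNoise (n := n) r
  have hsr := integrable_permSqNoise_mul (n := n) s r
  have expand (X : Fin n → Fin n → ℝ) :
      (permSqNoise n s X - n !) * (permSqNoise n r X - n !)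
        = permSqNoise n s X * permSqNoise n r X - n ! * permSqNoise n s X
          - n ! * permSqNoise n r X + (n ! : ℝ) ^ 2 := by
    ring
  simp only [cov, integral_permSqNoise, expand]
  have hs' := hs.const_mul (n ! : ℝ)
  have hr' := hr.const_mul (n ! : ℝ)
  have hsub : Integrable (fun X => permSqNoise n s X * permSqNoise n r X
      - n ! * permSqNoise n s X) (gMatR n) := hsr.sub hs'
  have hsub' : Integrable (fun X => permSqNoise n s X * permSqNoise n r X
      - n ! * permSqNoise n s X - n ! * permSqNoise n r X) (gMatR n) := hsub.sub hr'
  rw [integral_add hsub' (integrable_const _), integral_sub hsub hr',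
    integral_sub hsr hs', integral_permSqNoise_mul, hsum]
  simp only [integral_const_mul, integral_permSqNoise, integral_const, probReal_univ, one_smul]
  ring

end Correlation

end Moments

/-- corr(f,g) =
(Σ_{m=1}^{n}(m+1)(1−ε)^m)/(√(Σ_{m=1}^{n}(m+1))·√(Σ_{m=1}^{n}(m+1)(1−ε)^{2m})),
where f(X) = perm(X)² and g(X) = E[perm(Y)² | X] for an ε-noise Y of the n×n real
Gaussian matrix X. -/
theorem corr_perm_noisy_perm_real_sum_form (n : ℕ) (hn : 1 ≤ n)
    (ε : ℝ) (hε : ε ∈ Set.Ioo (0 : ℝ) 1) :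
    corr (gMatR n) (fun X => (rperm X) ^ 2) (gFunR n ε) =
      (∑ m ∈ Finset.Icc 1 n, ((m : ℝ) + 1) * (1 - ε) ^ m) /
        (Real.sqrt (∑ m ∈ Finset.Icc 1 n, ((m : ℝ) + 1)) *
          Real.sqrt (∑ m ∈ Finset.Icc 1 n, ((m : ℝ) + 1) * (1 - ε) ^ (2 * m))) := by
  obtain ⟨h0, h1⟩ := hε
  have hfac : (n.factorial : ℝ) ≠ 0 := by positivity
  rw [rperm_sq_eq_permSqNoise, gFunR_eq_permSqNoise h0.le h1.le, corr, cov_permSqNoise,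
    cov_permSqNoise, cov_permSqNoise, Real.sqrt_mul (sq_nonneg _), Real.sqrt_mul (sq_nonneg _),
    Real.sqrt_sq (Nat.cast_nonneg _), mul_mul_mul_comm, ← sq,
    mul_div_mul_left _ _ (pow_ne_zero 2 hfac)]
  simp only [one_mul, one_pow, mul_one, ← sq, ← pow_mul]
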